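/- Let b be a rational function in the closed unit ball of H∞ with ‖b‖∞ = 1 that is not a finite Blaschke product. Let φ ∈ H(b) ∩ ball(H∞) with φ(ξ_j) ∈ Z_T(a) for 1 ≤ j ≤ p and φ(ξ_j) ∈ D for p+1 ≤ j ≤ n; for 1 ≤ k ≤ p let ℓ_k be the index with φ(ξ_k) = ξ_{ℓ_k}. If the composition operator C_φ is compact on H(b), then m_k < m_{ℓ_k} for every 1 ≤ k ≤ p; in particular no ξ_k (1 ≤ k ≤ p) can be a fixed point of φ. -/

import Mathlib

open Complex MeasureTheory Set Filter

noncomputable section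

attribute [local instance] Classical.propDecidable

/-- The open unit disk in `ℂ`. -/
def unitDisk : Set ℂ := Metric.ball 0 1

/-- The unit circle in `ℂ`. -/
def unitCircle : Set ℂ := Metric.sphere 0 1

/-- Membership in `H^∞`: analytic and bounded on the unit disk. -/
def MemHinf (f : ℂ → ℂ) : Prop :=
  DifferentiableOn ℂ f unitDisk ∧ ∃ C : ℝ, ∀ z ∈ unitDisk, ‖f z‖ ≤ C

/-- Membership in the closed unit ball of `H^∞`. -/
def MemBallHinf (f : ℂ → ℂ) : Prop :=
  DifferentiableOn ℂ f unitDisk ∧ ∀ z ∈ unitDisk, ‖f z‖ ≤ 1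

/-- `f` agrees on the closed unit disk with a rational function without poles there. -/
def IsRationalOnDisk (f : ℂ → ℂ) : Prop :=
  ∃ P Q : Polynomial ℂ, ∀ z ∈ Metric.closedBall (0:ℂ) 1,
    Q.eval z ≠ 0 ∧ f z = P.eval z / Q.eval z

/-- `f` is a finite Blaschke product (multiplicities are encoded by repetition). -/
def IsFiniteBlaschke (f : ℂ → ℂ) : Prop :=
  ∃ (γ : ℂ) (k : ℕ) (lam : Fin k → ℂ), ‖γ‖ = 1 ∧ (∀ i, lam i ∈ unitDisk) ∧
    ∀ z ∈ unitDisk, f z = γ * ∏ i, (z - lam i) / (1 - (starRingEnd ℂ) (lam i) * z)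

/-- The `k`-th Taylor coefficient of `f` at the origin. -/
def taylorCoeff (f : ℂ → ℂ) (k : ℕ) : ℂ := iteratedDeriv k f 0 / k.factorial

/-- Membership in the Hardy space `H²` (square-summable Taylor coefficients). -/
def MemH2 (f : ℂ → ℂ) : Prop :=
  DifferentiableOn ℂ f unitDisk ∧ Summable fun k => ‖taylorCoeff f k‖ ^ 2

/-- The squared `H²` norm. -/
def h2NormSq (f : ℂ → ℂ) : ℝ := ∑' k, ‖taylorCoeff f k‖ ^ 2

/-- The `H²` inner product. -/
def h2Inner (f g : ℂ → ℂ) : ℂ :=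
  ∑' k, (starRingEnd ℂ) (taylorCoeff f k) * taylorCoeff g k

/-- The polynomial `a₁(z) = ∏ⱼ (z − ξⱼ)^{mⱼ}`. -/
def a1fun {n : ℕ} (ξ : Fin n → ℂ) (m : Fin n → ℕ) : ℂ → ℂ :=
  fun z => ∏ j, (z - ξ j) ^ (m j)

/-- A decomposition `f = a₁ g + q` with `g ∈ H²`, `deg q ≤ N − 1`, witnessing membership
in `H(b) = a₁H² ⊕ P_{N−1}`. -/
def HbDecompOf {n : ℕ} (ξ : Fin n → ℂ) (m : Fin n → ℕ)
    (f g : ℂ → ℂ) (q : Polynomial ℂ) : Prop :=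
  MemH2 g ∧ q.degree < ((∑ j, m j : ℕ) : WithBot ℕ) ∧
    ∀ z ∈ unitDisk, f z = a1fun ξ m z * g z + q.eval z

/-- Membership in `H(b) = a₁ H² ⊕ P_{N−1}` (description of `H(b)` for `b` rational,
not a finite Blaschke product, whose pythagorean mate has boundary zeros `ξ` with
multiplicities `m`). -/
def MemHb {n : ℕ} (ξ : Fin n → ℂ) (m : Fin n → ℕ) (f : ℂ → ℂ) : Prop :=
  ∃ gq : (ℂ → ℂ) × Polynomial ℂ, HbDecompOf ξ m f gq.1 gq.2

/-- The (unique) decomposition of a member of `H(b)`. -/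
def hbDecomp {n : ℕ} (ξ : Fin n → ℂ) (m : Fin n → ℕ) (f : ℂ → ℂ) :
    (ℂ → ℂ) × Polynomial ℂ :=
  if h : MemHb ξ m f then h.choose else (0, 0)

/-- The squared norm `⦀a₁g + q⦀² = ‖g‖²_{H²} + ‖q‖²_{H²}` on `H(b)`. -/
def hbNormSq {n : ℕ} (ξ : Fin n → ℂ) (m : Fin n → ℕ) (f : ℂ → ℂ) : ℝ :=
  h2NormSq (hbDecomp ξ m f).1 + h2NormSq fun z => ((hbDecomp ξ m f).2).eval z

/-- The inner product on `H(b)` induced by the decomposition. -/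
def hbInner {n : ℕ} (ξ : Fin n → ℂ) (m : Fin n → ℕ) (f g : ℂ → ℂ) : ℂ :=
  h2Inner (hbDecomp ξ m f).1 (hbDecomp ξ m g).1 +
    h2Inner (fun z => ((hbDecomp ξ m f).2).eval z)
      (fun z => ((hbDecomp ξ m g).2).eval z)

/-- The Stolz angle (non-tangential approach region) at a boundary point `ξ`. -/
def stolzAngle (ξ : ℂ) (M : ℝ) : Set ℂ := {z ∈ unitDisk | ‖z - ξ‖ ≤ M * (1 - ‖z‖)}

/-- `f` has non-tangential limit `L` at `ξ`. -/
def NTLimit (f : ℂ → ℂ) (ξ L : ℂ) : Prop :=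
  ∀ M : ℝ, 1 < M → Tendsto f (nhdsWithin ξ (stolzAngle ξ M)) (nhds L)

/-- Radial boundary value of `f` at `ζ` (junk value if the radial limit does not exist). -/
def bdryVal (f : ℂ → ℂ) (ζ : ℂ) : ℂ :=
  limUnder (nhdsWithin (1:ℝ) (Set.Iio 1)) fun r : ℝ => f ((r : ℂ) * ζ)

/-- The full setting: `b` is a rational function in the closed unit ball of `H^∞` with
`‖b‖_∞ = 1` which is not a finite Blaschke product; `a` is its pythagorean mate (rational,
outer — i.e. zero-free on the disk —, `a(0) > 0`, `|a|² + |b|² = 1` on the circle); the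
`ξ j` are the distinct zeros of `a` on the unit circle, with multiplicities `m j`. -/
structure RationalSetting (b a : ℂ → ℂ) (n : ℕ) (ξ : Fin n → ℂ) (m : Fin n → ℕ) :
    Prop where
  b_diff : DifferentiableOn ℂ b unitDisk
  b_rat : IsRationalOnDisk b
  b_le_one : ∀ z ∈ unitDisk, ‖b z‖ ≤ 1
  b_norm_one : sSup ((fun z => ‖b z‖) '' unitDisk) = 1
  b_not_fbp : ¬ IsFiniteBlaschke b
  a_diff : DifferentiableOn ℂ a unitDisk
  a_rat : IsRationalOnDisk a
  a_outer : ∀ z ∈ unitDisk, a z ≠ 0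
  a_zero_pos : 0 < (a 0).re ∧ (a 0).im = 0
  pyth : ∀ ζ ∈ unitCircle, ‖a ζ‖ ^ 2 + ‖b ζ‖ ^ 2 = 1
  zeros_mem : ∀ j, ξ j ∈ unitCircle
  zeros_inj : Function.Injective ξ
  mult_pos : ∀ j, 0 < m j
  factor : ∃ g : ℂ → ℂ, IsRationalOnDisk g ∧ (∀ ζ ∈ unitCircle, g ζ ≠ 0) ∧
    ∀ z ∈ Metric.closedBall (0:ℂ) 1, a z = a1fun ξ m z * g z

/-- The composition operator `C_φ` maps `H(b)` into itself and is bounded there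
(with respect to the equivalent norm `⦀·⦀_b`). -/
def CompBddHb {n : ℕ} (ξ : Fin n → ℂ) (m : Fin n → ℕ) (φ : ℂ → ℂ) : Prop :=
  (∀ f, MemHb ξ m f → MemHb ξ m fun z => f (φ z)) ∧
  ∃ C : ℝ, ∀ f, MemHb ξ m f →
    hbNormSq ξ m (fun z => f (φ z)) ≤ C * hbNormSq ξ m f

/-- The composition operator `C_φ` is compact on `H(b)`: it is bounded and the image of
every sequence in the unit ball has a subsequence whose image converges in `H(b)`. -/
def CompCompactHb {n : ℕ} (ξ : Fin n → ℂ) (m : Fin n → ℕ) (φ : ℂ → ℂ) : Prop :=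
  CompBddHb ξ m φ ∧
  ∀ f : ℕ → ℂ → ℂ, (∀ k, MemHb ξ m (f k) ∧ hbNormSq ξ m (f k) ≤ 1) →
    ∃ (κ : ℕ → ℕ) (g : ℂ → ℂ), StrictMono κ ∧ MemHb ξ m g ∧
      Tendsto (fun i => hbNormSq ξ m fun z => f (κ i) (φ z) - g z) atTop (nhds 0)

/-- The composition operator `C_φ` is Hilbert–Schmidt on `H(b)`: it is bounded and the sum
of `⦀C_φ e⦀²` over the orthonormal basis `{a₁ z^k}ₖ ∪ {z^j}_{j<N}` of
`(H(b), ⦀·⦀_b)` is finite (the finite part of the sum being automatically finite). -/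
def CompHSHb {n : ℕ} (ξ : Fin n → ℂ) (m : Fin n → ℕ) (φ : ℂ → ℂ) : Prop :=
  CompBddHb ξ m φ ∧
  Summable fun k : ℕ => hbNormSq ξ m fun z => a1fun ξ m (φ z) * φ z ^ k

/-- The weighted composition operator `W_{u,φ} f = u · (f ∘ φ)` maps `H²` boundedly
into itself. -/
def WCompBddH2 (u φ : ℂ → ℂ) : Prop :=
  (∀ f, MemH2 f → MemH2 fun z => u z * f (φ z)) ∧
  ∃ C : ℝ, ∀ f, MemH2 f →
    h2NormSq (fun z => u z * f (φ z)) ≤ C * h2NormSq f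

/-- The weighted composition operator `W_{u,φ}` is compact on `H²`. -/
def WCompCompactH2 (u φ : ℂ → ℂ) : Prop :=
  WCompBddH2 u φ ∧
  ∀ f : ℕ → ℂ → ℂ, (∀ k, MemH2 (f k) ∧ h2NormSq (f k) ≤ 1) →
    ∃ (κ : ℕ → ℕ) (g : ℂ → ℂ), StrictMono κ ∧ MemH2 g ∧
      Tendsto (fun i => h2NormSq fun z => u z * f (κ i) (φ z) - g z) atTop (nhds 0)

/-- The weighted composition operator `W_{u,φ}` is Hilbert–Schmidt on `H²`
(sum over the orthonormal basis `{z^k}` of `H²`). -/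
def WCompHSH2 (u φ : ℂ → ℂ) : Prop :=
  WCompBddH2 u φ ∧ Summable fun k : ℕ => h2NormSq fun z => u z * φ z ^ k

/-- The function `u = (a₁ ∘ φ) · ∏_{j ≥ p} (φ − φ(ξⱼ))^{mⱼ} / a₁`, where `Λ j = φ(ξ j)`
are the non-tangential limits of `φ` at the zeros of the mate. -/
def ufun {n : ℕ} (p : ℕ) (ξ : Fin n → ℂ) (m : Fin n → ℕ) (Λ : Fin n → ℂ)
    (φ : ℂ → ℂ) : ℂ → ℂ :=
  fun z => a1fun ξ m (φ z) *
    (∏ j ∈ Finset.univ.filter fun j : Fin n => p ≤ (j : ℕ), (φ z - Λ j) ^ (m j)) /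
      a1fun ξ m z

/-- The reproducing kernel of the de Branges–Rovnyak space `H(c)`:
`k_λ^c(z) = (1 − conj(c(λ)) c(z)) / (1 − conj(λ) z)`, as a function of the parameter `λ`
and the evaluation point `z`. -/
def rkKernel (c : ℂ → ℂ) (lam z : ℂ) : ℂ :=
  (1 - (starRingEnd ℂ) (c lam) * c z) / (1 - (starRingEnd ℂ) lam * z)

/-- `f` belongs to the reproducing kernel Hilbert space `H(c)` with squared norm at
most `t`: for all finite linear combinations of kernels,
`|⟨f, Σ αᵢ k_{λᵢ}⟩|² ≤ t · ‖Σ αᵢ k_{λᵢ}‖²`. -/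
def HbRKBound (c f : ℂ → ℂ) (t : ℝ) : Prop :=
  ∀ (k : ℕ) (lam α : Fin k → ℂ), (∀ i, lam i ∈ unitDisk) →
    ‖∑ i, (starRingEnd ℂ) (α i) * f (lam i)‖ ^ 2 ≤
      t * (∑ i, ∑ j, α i * (starRingEnd ℂ) (α j) * rkKernel c (lam i) (lam j)).re

/-- Membership in the de Branges–Rovnyak space `H(c)` (general RKHS definition). -/
def MemHbRK (c f : ℂ → ℂ) : Prop := ∃ t : ℝ, HbRKBound c f t

/-- `φ` has an angular derivative in the sense of Carathéodory at `ξ`: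
`φ` and `φ'` have non-tangential limits at `ξ` and `|φ(ξ)| = 1`. -/
def HasADC (φ : ℂ → ℂ) (ξ : ℂ) : Prop :=
  ∃ L L' : ℂ, ‖L‖ = 1 ∧ NTLimit φ ξ L ∧ NTLimit (deriv φ) ξ L'

/-- The measure `μ_{u,φ}(E) = ∫_{φ⁻¹(E) ∩ T} |u|² dm` (boundary values on the circle,
normalized Lebesgue measure). -/
def muMeas (u φ : ℂ → ℂ) (E : Set ℂ) : ENNReal :=
  (ENNReal.ofReal (2 * Real.pi))⁻¹ *
    ∫⁻ θ in Set.Ioc (0:ℝ) (2 * Real.pi),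
      (if bdryVal φ (Complex.exp (θ * Complex.I)) ∈ E then
        ENNReal.ofReal (‖bdryVal u (Complex.exp (θ * Complex.I))‖ ^ 2) else 0)

/-- `μ_{u,φ}` is a Carleson measure: `μ(S(ζ,r)) ≤ M r` for all Carleson windows
`S(ζ,r) = {z : |z| ≤ 1, |z − ζ| ≤ r}`, `ζ ∈ T`, `0 < r < 1`. -/
def IsCarleson (u φ : ℂ → ℂ) : Prop :=
  ∃ M : ℝ, 0 < M ∧ ∀ ζ ∈ unitCircle, ∀ r ∈ Set.Ioo (0:ℝ) 1,
    muMeas u φ (Metric.closedBall ζ r ∩ Metric.closedBall 0 1) ≤ ENNReal.ofReal (M * r)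

/-- `μ_{u,φ}` is a vanishing Carleson measure: `sup_{ζ∈T} μ(S(ζ,r))/r → 0` as `r → 0`. -/
def IsVanishingCarleson (u φ : ℂ → ℂ) : Prop :=
  ∀ ε > (0:ℝ), ∃ r₀ ∈ Set.Ioo (0:ℝ) 1, ∀ r ∈ Set.Ioo (0:ℝ) r₀, ∀ ζ ∈ unitCircle,
    muMeas u φ (Metric.closedBall ζ r ∩ Metric.closedBall 0 1) ≤ ENNReal.ofReal (ε * r)

/-- The reproducing kernel integral
`∫_T (1 − |w|²) |u(ξ)|² / |1 − conj(w) φ(ξ)|² dm(ξ)`. -/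
def repKerInt (u φ : ℂ → ℂ) (w : ℂ) : ENNReal :=
  (ENNReal.ofReal (2 * Real.pi))⁻¹ *
    ∫⁻ θ in Set.Ioc (0:ℝ) (2 * Real.pi),
      ENNReal.ofReal ((1 - ‖w‖ ^ 2) * ‖bdryVal u (Complex.exp (θ * Complex.I))‖ ^ 2 /
        ‖1 - (starRingEnd ℂ) w * bdryVal φ (Complex.exp (θ * Complex.I))‖ ^ 2)

open Topology Polynomial

theorem hasSum_of_eq {E : Type*} [AddCommMonoid E] [TopologicalSpace E] {f g : ℕ → E} {a : E}
    (h : ∀ k, f k = g k) (hf : HasSum f a) : HasSum g a := by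
  rwa [← funext h]

theorem taylorCoeff_of_hasSum (f : ℂ → ℂ) (c : ℕ → ℂ)
    (h : ∀ z ∈ unitDisk, HasSum (fun k => c k * z ^ k) (f z)) (k : ℕ) :
    taylorCoeff f k = c k := by
  have h1 : HasFPowerSeriesAt f (FormalMultilinearSeries.ofScalars ℂ c) 0 := by
    rw [hasFPowerSeriesAt_iff]
    filter_upwards [Metric.ball_mem_nhds (0:ℂ) one_pos] with z hz
    have := h z hz
    simpa [FormalMultilinearSeries.coeff_ofScalars, mul_comm] using this
  have h2 := h1.analyticAt.hasFPowerSeriesAt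
  have h3 := h2.eq_formalMultilinearSeries h1
  have h4 := congrArg (fun p => FormalMultilinearSeries.coeff p k) h3
  simpa [FormalMultilinearSeries.coeff_ofScalars, taylorCoeff] using h4

theorem hasSum_taylorCoeff {f : ℂ → ℂ} (hf : DifferentiableOn ℂ f unitDisk) {z : ℂ}
    (hz : z ∈ unitDisk) : HasSum (fun k => taylorCoeff f k * z ^ k) (f z) := by
  have := Complex.hasSum_taylorSeries_on_ball hf hz
  refine hasSum_of_eq (fun k => ?_) this
  simp only [taylorCoeff, div_eq_inv_mul, smul_eq_mul, sub_zero]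
  ring

theorem h2NormSq_nonneg (f : ℂ → ℂ) : 0 ≤ h2NormSq f := tsum_nonneg fun _ => by positivity

theorem norm_lt_of_mem {z : ℂ} (hz : z ∈ unitDisk) : ‖z‖ < 1 := by
  simpa [unitDisk] using hz

theorem mem_of_norm_lt {z : ℂ} (hz : ‖z‖ < 1) : z ∈ unitDisk := by
  simpa [unitDisk] using hz

theorem h2_growth {g : ℂ → ℂ} (hg : MemH2 g) {z : ℂ} (hz : z ∈ unitDisk) :
    ‖g z‖ ≤ √(h2NormSq g) / √(1 - ‖z‖) := by
  have hz1 := norm_lt_of_mem hz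
  have hs := hasSum_taylorCoeff hg.1 hz
  refine le_of_tendsto hs.norm (Eventually.of_forall fun s => ?_)
  rw [← Real.sqrt_div (h2NormSq_nonneg g)]
  apply Real.le_sqrt_of_sq_le
  have e1 : ‖∑ k ∈ s, taylorCoeff g k * z ^ k‖ ≤ ∑ k ∈ s, ‖taylorCoeff g k‖ * ‖z‖ ^ k := by
    refine (norm_sum_le _ _).trans (le_of_eq ?_)
    simp
  have e2 := Finset.sum_mul_sq_le_sq_mul_sq s (fun k => ‖taylorCoeff g k‖) (fun k => ‖z‖ ^ k)
  have e3 : ∑ k ∈ s, ‖taylorCoeff g k‖ ^ 2 ≤ h2NormSq g :=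
    hg.2.sum_le_tsum s (fun _ _ => by positivity)
  have e4 : ∑ k ∈ s, (‖z‖ ^ k) ^ 2 ≤ (1 - ‖z‖)⁻¹ := by
    calc ∑ k ∈ s, (‖z‖ ^ k) ^ 2 ≤ ∑ k ∈ s, ‖z‖ ^ k := by
          apply Finset.sum_le_sum
          intro k _
          have : ‖z‖ ^ k ≤ 1 := pow_le_one₀ (norm_nonneg _) hz1.le
          nlinarith [pow_nonneg (norm_nonneg z) k]
      _ ≤ (1 - ‖z‖)⁻¹ := by
          rw [← tsum_geometric_of_lt_one (norm_nonneg _) hz1]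
          exact (summable_geometric_of_lt_one (norm_nonneg _) hz1).sum_le_tsum s
            (fun _ _ => by positivity)
  calc _ ≤ (∑ k ∈ s, ‖taylorCoeff g k‖ * ‖z‖ ^ k) ^ 2 := by gcongr
    _ ≤ _ := e2
    _ ≤ h2NormSq g * (1 - ‖z‖)⁻¹ := by
      gcongr
      exact h2NormSq_nonneg g
    _ = _ := by rw [div_eq_mul_inv]

theorem taylorCoeff_congr {f g : ℂ → ℂ} (hg : DifferentiableOn ℂ g unitDisk)
    (h : ∀ z ∈ unitDisk, f z = g z) (k : ℕ) : taylorCoeff f k = taylorCoeff g k := by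
  apply taylorCoeff_of_hasSum
  intro z hz
  rw [h z hz]
  exact hasSum_taylorCoeff hg hz

theorem h2NormSq_congr {f g : ℂ → ℂ} (hg : DifferentiableOn ℂ g unitDisk)
    (h : ∀ z ∈ unitDisk, f z = g z) : h2NormSq f = h2NormSq g := by
  simp only [h2NormSq, taylorCoeff_congr hg h]

theorem memH2_sub {f g : ℂ → ℂ} (hf : MemH2 f) (hg : MemH2 g) :
    MemH2 (fun z => f z - g z) := by
  refine ⟨hf.1.sub hg.1, ?_⟩
  have : ∀ k, taylorCoeff (fun z => f z - g z) k = taylorCoeff f k - taylorCoeff g k := by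
    intro k
    apply taylorCoeff_of_hasSum _ (fun k => taylorCoeff f k - taylorCoeff g k)
    intro z hz
    simpa [sub_mul] using (hasSum_taylorCoeff hf.1 hz).sub (hasSum_taylorCoeff hg.1 hz)
  simp only [this]
  refine Summable.of_nonneg_of_le (fun _ => by positivity) (fun k => ?_)
    ((hf.2.mul_left 2).add (hg.2.mul_left 2))
  have h1 := norm_sub_le (taylorCoeff f k) (taylorCoeff g k)
  have h2 := norm_nonneg (taylorCoeff f k - taylorCoeff g k)
  nlinarith [sq_nonneg (‖taylorCoeff f k‖ - ‖taylorCoeff g k‖)]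

theorem taylorCoeff_poly (q : ℂ[X]) (k : ℕ) :
    taylorCoeff (fun z => q.eval z) k = q.coeff k := by
  apply taylorCoeff_of_hasSum _ q.coeff
  intro z _
  rw [Polynomial.eval_eq_sum, Polynomial.sum]
  apply hasSum_sum_of_ne_finset_zero
  intro b hb
  rw [Polynomial.notMem_support_iff.1 hb, zero_mul]

theorem memH2_poly (q : ℂ[X]) : MemH2 (fun z => q.eval z) := by
  refine ⟨q.differentiable.differentiableOn, ?_⟩
  simp only [taylorCoeff_poly]
  apply summable_of_ne_finset_zero (s := q.support)
  intro b hb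
  rw [Polynomial.notMem_support_iff.1 hb]
  simp

theorem coeff_le_h2 (q : ℂ[X]) (k : ℕ) : ‖q.coeff k‖ ≤ √(h2NormSq fun z => q.eval z) := by
  apply Real.le_sqrt_of_sq_le
  have := (memH2_poly q).2.le_tsum k (fun _ _ => by positivity)
  rwa [taylorCoeff_poly] at this

/-- normalized Szego kernel -/
def khat (w z : ℂ) : ℂ := (√(1 - ‖w‖ ^ 2) : ℝ) / (1 - (starRingEnd ℂ) w * z)

theorem taylorCoeff_khat {w : ℂ} (hw : w ∈ unitDisk) (k : ℕ) :
    taylorCoeff (khat w) k = (√(1 - ‖w‖ ^ 2) : ℝ) * ((starRingEnd ℂ) w) ^ k := by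
  apply taylorCoeff_of_hasSum _ (fun k => (√(1 - ‖w‖ ^ 2) : ℝ) * ((starRingEnd ℂ) w) ^ k)
  intro z hz
  have h1 : ‖(starRingEnd ℂ) w * z‖ < 1 := by
    rw [norm_mul, RCLike.norm_conj]
    have := norm_lt_of_mem hz
    have := norm_lt_of_mem hw
    nlinarith [norm_nonneg z, norm_nonneg w]
  have := (hasSum_geometric_of_norm_lt_one h1).mul_left ((√(1 - ‖w‖ ^ 2) : ℝ) : ℂ)
  rw [khat, div_eq_mul_inv]
  refine hasSum_of_eq (fun k => ?_) this
  rw [mul_pow, mul_assoc]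

theorem khat_denom {w z : ℂ} (hw : w ∈ unitDisk) (hz : z ∈ unitDisk) :
    1 - ‖w‖ ≤ ‖1 - (starRingEnd ℂ) w * z‖ ∧ 1 - ‖z‖ ≤ ‖1 - (starRingEnd ℂ) w * z‖ := by
  have h := norm_sub_norm_le (1:ℂ) ((starRingEnd ℂ) w * z)
  rw [norm_mul, RCLike.norm_conj, norm_one] at h
  have := norm_lt_of_mem hz
  have := norm_lt_of_mem hw
  constructor <;> nlinarith [norm_nonneg z, norm_nonneg w]

theorem khat_memH2 {w : ℂ} (hw : w ∈ unitDisk) : MemH2 (khat w) ∧ h2NormSq (khat w) = 1 := by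
  have hw1 := norm_lt_of_mem hw
  have hs : 0 < 1 - ‖w‖ ^ 2 := by nlinarith [norm_nonneg w]
  have hS : HasSum (fun k => ‖taylorCoeff (khat w) k‖ ^ 2) 1 := by
    have h := (hasSum_geometric_of_lt_one (sq_nonneg ‖w‖) (by linarith)).mul_left (1 - ‖w‖ ^ 2)
    rw [mul_inv_cancel₀ hs.ne'] at h
    refine hasSum_of_eq (fun k => ?_) h
    symm
    rw [taylorCoeff_khat hw, norm_mul, mul_pow, Complex.norm_real, Real.norm_eq_abs, sq_abs,
      Real.sq_sqrt hs.le, norm_pow, RCLike.norm_conj, ← pow_mul, ← pow_mul, mul_comm k]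
  refine ⟨⟨?_, hS.summable⟩, hS.tsum_eq⟩
  unfold khat
  apply DifferentiableOn.div (by fun_prop) (by fun_prop)
  intro z hz h0
  have := (khat_denom hw hz).1
  rw [h0, norm_zero] at this
  linarith

theorem dvd_of_small (q : ℂ[X]) (ξ : ℂ) (hξ : ‖ξ‖ = 1) (m : ℕ)
    (h : Tendsto (fun r : ℝ => ‖q.eval (r * ξ)‖ / (1 - r) ^ (m - 1)) (𝓝[<] 1) (𝓝 0)) :
    (X - C ξ) ^ m ∣ q := by
  by_cases hq : q = 0
  · simp [hq]
  obtain ⟨u, hu, hnd⟩ := q.exists_eq_pow_rootMultiplicity_mul_and_not_dvd hq ξ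
  set s := q.rootMultiplicity ξ
  by_cases hsm : m ≤ s
  · rw [hu]
    exact (pow_dvd_pow _ hsm).mul_right _
  exfalso
  apply hnd
  rw [Polynomial.dvd_iff_isRoot, IsRoot]
  have h1 : Tendsto (fun r : ℝ => ‖u.eval (r * ξ)‖) (𝓝[<] 1) (𝓝 ‖u.eval ξ‖) := by
    have : Continuous (fun r : ℝ => ‖u.eval (r * ξ)‖) := by fun_prop
    simpa using (this.tendsto 1).mono_left nhdsWithin_le_nhds
  have h2 : Tendsto (fun r : ℝ => ‖u.eval (r * ξ)‖) (𝓝[<] 1) (𝓝 0) := by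
    refine squeeze_zero' (Eventually.of_forall fun _ => norm_nonneg _) ?_ h
    filter_upwards [Ioo_mem_nhdsLT (zero_lt_one' ℝ)] with r hr
    have e : ‖q.eval (r * ξ)‖ = (1 - r) ^ s * ‖u.eval (r * ξ)‖ := by
      conv_lhs => rw [hu]
      simp only [eval_mul, eval_pow, eval_sub, eval_X, eval_C, norm_mul, norm_pow]
      congr 2
      have : (r : ℂ) * ξ - ξ = ((r - 1 : ℝ) : ℂ) * ξ := by push_cast; ring
      rw [this, norm_mul, hξ, mul_one, Complex.norm_real, Real.norm_eq_abs, abs_sub_comm,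
        abs_of_pos (by linarith [hr.2])]
    rw [e, le_div_iff₀ (pow_pos (by linarith [hr.2]) _), mul_comm]
    gcongr ?_ * _
    exact pow_le_pow_of_le_one (by linarith [hr.2]) (by linarith [hr.1]) (by omega)
  exact norm_eq_zero.1 (tendsto_nhds_unique h1 h2)

theorem poly_as_sum (q : ℂ[X]) (N : ℕ) (hq : q.degree < (N : WithBot ℕ)) :
    q = ∑ i ∈ Finset.range N, C (q.coeff i) * X ^ i := by
  ext k
  rw [Polynomial.finsetSum_coeff]
  simp only [coeff_C_mul, coeff_X_pow, mul_ite, mul_one, mul_zero, Finset.sum_ite_eq,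
    Finset.mem_range]
  split_ifs with h
  · rfl
  · exact (Polynomial.degree_lt_iff_coeff_zero q N).1 hq k (by omega)

theorem poly_small (N m : ℕ) (ξ : ℂ) : ∃ K : ℝ, 0 ≤ K ∧ ∀ q : ℂ[X], q.degree < (N : WithBot ℕ) →
    (X - C ξ) ^ m ∣ q → ∀ z : ℂ, ‖z - ξ‖ ≤ 1 →
    ‖q.eval z‖ ≤ K * √(h2NormSq fun z => q.eval z) * ‖z - ξ‖ ^ m := by
  refine ⟨∑ j ∈ Finset.range N, ∑ i ∈ Finset.range N, ‖((X + C ξ) ^ i : ℂ[X]).coeff j‖,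
    by positivity, ?_⟩
  intro q hq hdvd z hz
  set S := √(h2NormSq fun z => q.eval z)
  have hS : 0 ≤ S := Real.sqrt_nonneg _
  set t := q.taylor ξ with ht
  have htd : t.degree < N := by
    rw [ht, Polynomial.degree_taylor]; exact hq
  have hev : q.eval z = t.eval (z - ξ) := by
    rw [ht, Polynomial.taylor_eval]; simp
  have hX : X ^ m ∣ t := by
    obtain ⟨v, rfl⟩ := hdvd
    rw [ht, Polynomial.taylor_mul, Polynomial.taylor_pow]
    simp
  have hb : ∀ j, ‖t.coeff j‖ ≤
      (∑ i ∈ Finset.range N, ‖((X + C ξ) ^ i : ℂ[X]).coeff j‖) * S := by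
    intro j
    have : t = ∑ i ∈ Finset.range N, C (q.coeff i) * (X + C ξ) ^ i := by
      conv_lhs => rw [ht, poly_as_sum q N hq]
      simp only [map_sum, Polynomial.taylor_mul, Polynomial.taylor_pow, Polynomial.taylor_C,
        Polynomial.taylor_X]
    rw [this, Polynomial.finsetSum_coeff, Finset.sum_mul]
    refine (norm_sum_le _ _).trans (Finset.sum_le_sum fun i _ => ?_)
    rw [coeff_C_mul, norm_mul, mul_comm]
    gcongr
    exact coeff_le_h2 q i
  rw [hev]
  have hsum : t.eval (z - ξ) = ∑ j ∈ Finset.range N, t.coeff j * (z - ξ) ^ j := by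
    conv_lhs => rw [poly_as_sum t N htd]
    simp [Polynomial.eval_finsetSum]
  rw [hsum, Finset.sum_mul, Finset.sum_mul]
  refine (norm_sum_le _ _).trans (Finset.sum_le_sum fun j _ => ?_)
  rw [norm_mul, norm_pow]
  by_cases hj : j < m
  · rw [Polynomial.X_pow_dvd_iff.1 hX j hj]
    simp only [norm_zero, zero_mul]
    positivity
  · gcongr ?_ * ?_
    · exact hb j
    · exact pow_le_pow_of_le_one (norm_nonneg _) hz (by omega)

theorem norm_radial_sub {ξ : ℂ} (hξ : ‖ξ‖ = 1) {r : ℝ} (hr : r < 1) :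
    ‖(r : ℂ) * ξ - ξ‖ = 1 - r := by
  have : (r : ℂ) * ξ - ξ = ((r - 1 : ℝ) : ℂ) * ξ := by push_cast; ring
  rw [this, norm_mul, hξ, mul_one, Complex.norm_real, Real.norm_eq_abs, abs_sub_comm,
    abs_of_pos (by linarith)]

theorem norm_radial {ξ : ℂ} (hξ : ‖ξ‖ = 1) {r : ℝ} (hr : 0 < r) : ‖(r : ℂ) * ξ‖ = r := by
  rw [norm_mul, hξ, mul_one, Complex.norm_real, Real.norm_eq_abs, abs_of_pos hr]

theorem radial_mem {ξ : ℂ} (hξ : ‖ξ‖ = 1) {r : ℝ} (hr : r ∈ Set.Ioo (0:ℝ) 1) :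
    (r : ℂ) * ξ ∈ unitDisk := by
  apply mem_of_norm_lt
  rw [norm_radial hξ hr.1]
  exact hr.2

theorem radial_tendsto {ξ : ℂ} : Tendsto (fun r : ℝ => (r : ℂ) * ξ) (𝓝[<] 1) (𝓝 ξ) := by
  have : Continuous (fun r : ℝ => (r : ℂ) * ξ) := by fun_prop
  simpa using (this.tendsto 1).mono_left nhdsWithin_le_nhds

theorem ntlimit_radial {f : ℂ → ℂ} {ξ L : ℂ} (hξ : ‖ξ‖ = 1) (h : NTLimit f ξ L) :
    Tendsto (fun r : ℝ => f (r * ξ)) (𝓝[<] 1) (𝓝 L) := by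
  refine (h 2 (by norm_num)).comp (tendsto_nhdsWithin_iff.2 ⟨radial_tendsto, ?_⟩)
  filter_upwards [Ioo_mem_nhdsLT (zero_lt_one' ℝ)] with r hr
  refine ⟨radial_mem hξ hr, ?_⟩
  rw [norm_radial_sub hξ hr.2, norm_radial hξ hr.1]
  linarith [hr.2]

theorem a1fun_split {n : ℕ} (ξ : Fin n → ℂ) (m : Fin n → ℕ) (k : Fin n) (z : ℂ) :
    a1fun ξ m z = (z - ξ k) ^ m k * ∏ j ∈ Finset.univ.erase k, (z - ξ j) ^ (m j) := by
  unfold a1fun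
  exact (Finset.mul_prod_erase Finset.univ (fun j => (z - ξ j) ^ (m j)) (Finset.mem_univ k)).symm

theorem a1fun_upper {n : ℕ} (ξ : Fin n → ℂ) (m : Fin n → ℕ) (k : Fin n) :
    ∃ C : ℝ, 0 ≤ C ∧ ∀ z : ℂ, ‖z‖ ≤ 1 → ‖a1fun ξ m z‖ ≤ C * ‖z - ξ k‖ ^ m k := by
  have hc : Continuous (fun z : ℂ => ∏ j ∈ Finset.univ.erase k, (z - ξ j) ^ (m j)) := by fun_prop
  obtain ⟨C, hC⟩ := (isCompact_closedBall (0:ℂ) 1).exists_bound_of_continuousOn hc.continuousOn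
  refine ⟨C, (norm_nonneg _).trans (hC 0 (by simp)), fun z hz => ?_⟩
  rw [a1fun_split ξ m k, norm_mul, norm_pow, mul_comm]
  gcongr
  exact hC z (by simpa using hz)

theorem a1fun_lower {n : ℕ} (ξ : Fin n → ℂ) (m : Fin n → ℕ) (hinj : Function.Injective ξ)
    (k : Fin n) :
    ∃ c : ℝ, 0 < c ∧ ∀ᶠ z in 𝓝 (ξ k), c * ‖z - ξ k‖ ^ m k ≤ ‖a1fun ξ m z‖ := by
  have hc : Continuous (fun z : ℂ => ‖∏ j ∈ Finset.univ.erase k, (z - ξ j) ^ (m j)‖) := by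
    fun_prop
  have hne : 0 < ‖∏ j ∈ Finset.univ.erase k, (ξ k - ξ j) ^ (m j)‖ := by
    rw [norm_pos_iff, Finset.prod_ne_zero_iff]
    intro j hj
    apply pow_ne_zero
    rw [sub_ne_zero]
    exact fun h => (Finset.ne_of_mem_erase hj) (hinj h).symm
  refine ⟨_, half_pos hne, ?_⟩
  filter_upwards [(hc.tendsto (ξ k)).eventually (lt_mem_nhds (half_lt_self hne))] with z hz
  rw [a1fun_split ξ m k z, norm_mul, norm_pow, mul_comm]
  gcongr

theorem a1fun_ne {n : ℕ} (ξ : Fin n → ℂ) (m : Fin n → ℕ) (hξ : ∀ j, ‖ξ j‖ = 1) {z : ℂ}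
    (hz : z ∈ unitDisk) : a1fun ξ m z ≠ 0 := by
  unfold a1fun
  rw [Finset.prod_ne_zero_iff]
  intro j _
  apply pow_ne_zero
  rw [sub_ne_zero]
  rintro rfl
  have := norm_lt_of_mem hz
  rw [hξ j] at this
  exact lt_irrefl _ this

theorem a1g_small {n : ℕ} (ξ : Fin n → ℂ) (m : Fin n → ℕ) (hξ : ∀ j, ‖ξ j‖ = 1) (k : Fin n) :
    ∃ C : ℝ, 0 ≤ C ∧ ∀ g, MemH2 g → ∀ r ∈ Set.Ioo (0:ℝ) 1,
      ‖a1fun ξ m (r * ξ k) * g (r * ξ k)‖ ≤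
        C * √(h2NormSq g) * ((1 - r) ^ m k / √(1 - r)) := by
  obtain ⟨C, hC0, hC⟩ := a1fun_upper ξ m k
  refine ⟨C, hC0, fun g hg r hr => ?_⟩
  have h1 := hC (r * ξ k) (norm_lt_of_mem (radial_mem (hξ k) hr)).le
  have h2 := h2_growth hg (radial_mem (hξ k) hr)
  rw [norm_radial_sub (hξ k) hr.2] at h1
  rw [norm_radial (hξ k) hr.1] at h2
  have : 0 ≤ 1 - r := by linarith [hr.2]
  rw [norm_mul]
  calc _ ≤ (C * (1 - r) ^ m k) * (√(h2NormSq g) / √(1 - r)) := by gcongr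
    _ = _ := by ring

theorem pow_div_sqrt {x : ℝ} (hx : 0 < x) {m : ℕ} (hm : 0 < m) :
    x ^ m / √x = √x * x ^ (m - 1) := by
  obtain ⟨j, rfl⟩ : ∃ j, m = j + 1 := ⟨m - 1, by omega⟩
  have h := Real.sq_sqrt hx.le
  have h' : 0 < √x := Real.sqrt_pos.2 hx
  rw [div_eq_iff h'.ne', Nat.add_sub_cancel, pow_succ]
  linear_combination (-(x ^ j)) * h

theorem sqrt_one_sub_tendsto : Tendsto (fun r : ℝ => √(1 - r)) (𝓝[<] 1) (𝓝 0) := by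
  have : Continuous (fun r : ℝ => √(1 - r)) := by fun_prop
  simpa using (this.tendsto 1).mono_left nhdsWithin_le_nhds

theorem a1g_tendsto {n : ℕ} (ξ : Fin n → ℂ) (m : Fin n → ℕ) (hξ : ∀ j, ‖ξ j‖ = 1)
    (hm : ∀ j, 0 < m j) (k : Fin n) {g : ℂ → ℂ} (hg : MemH2 g) (s : ℕ) (hs : s ≤ m k - 1) :
    Tendsto (fun r : ℝ => ‖a1fun ξ m (r * ξ k) * g (r * ξ k)‖ / (1 - r) ^ s)
      (𝓝[<] 1) (𝓝 0) := by
  obtain ⟨C, hC0, hC⟩ := a1g_small ξ m hξ k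
  have h := sqrt_one_sub_tendsto.const_mul (C * √(h2NormSq g))
  rw [mul_zero] at h
  refine squeeze_zero' ?_ ?_ h
  · filter_upwards [Ioo_mem_nhdsLT (zero_lt_one' ℝ)] with r hr
    have : 0 ≤ 1 - r := by linarith [hr.2]
    positivity
  filter_upwards [Ioo_mem_nhdsLT (zero_lt_one' ℝ)] with r hr
  have h0 : 0 < 1 - r := by linarith [hr.2]
  have := hC g hg r hr
  rw [pow_div_sqrt h0 (hm k)] at this
  rw [div_le_iff₀ (by positivity)]
  refine this.trans ?_
  rw [← mul_assoc]
  gcongr ?_ * ?_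
  exact pow_le_pow_of_le_one h0.le (by linarith [hr.1]) hs

theorem hb_unique {n : ℕ} (ξ : Fin n → ℂ) (m : Fin n → ℕ) (hξ : ∀ j, ‖ξ j‖ = 1)
    (hinj : Function.Injective ξ) (hm : ∀ j, 0 < m j) {f g g' : ℂ → ℂ} {q q' : ℂ[X]}
    (h : HbDecompOf ξ m f g q) (h' : HbDecompOf ξ m f g' q') :
    q = q' ∧ ∀ z ∈ unitDisk, g z = g' z := by
  have key : ∀ z ∈ unitDisk, (q - q').eval z = a1fun ξ m z * (g' z - g z) := by
    intro z hz
    have e1 := h.2.2 z hz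
    have e2 := h'.2.2 z hz
    rw [eval_sub]
    linear_combination e2 - e1
  have hG := memH2_sub h'.1 h.1
  have hd : ∀ j, (X - C (ξ j)) ^ m j ∣ q - q' := by
    intro j
    apply dvd_of_small _ _ (hξ j)
    refine (a1g_tendsto ξ m hξ hm j hG (m j - 1) le_rfl).congr' ?_
    filter_upwards [Ioo_mem_nhdsLT (zero_lt_one' ℝ)] with r hr
    rw [key _ (radial_mem (hξ j) hr)]
  have hprod : ∏ j, (X - C (ξ j)) ^ m j ∣ q - q' := by
    apply Finset.prod_dvd_of_coprime
    · intro i _ j _ hij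
      exact (Polynomial.pairwise_coprime_X_sub_C hinj hij).pow
    · intro j _
      exact hd j
  have hdeg : (∏ j, (X - C (ξ j)) ^ m j : ℂ[X]).degree = ((∑ j, m j : ℕ) : WithBot ℕ) := by
    rw [Polynomial.degree_prod]
    simp
  have hq : q - q' = 0 := by
    apply Polynomial.eq_zero_of_dvd_of_degree_lt hprod
    rw [hdeg]
    exact (Polynomial.degree_sub_le _ _).trans_lt (max_lt h.2.1 h'.2.1)
  refine ⟨sub_eq_zero.1 hq, fun z hz => ?_⟩
  have := key z hz
  rw [hq, eval_zero] at this
  rcases mul_eq_zero.1 this.symm with h0 | h0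
  · exact absurd h0 (a1fun_ne ξ m hξ hz)
  · exact (sub_eq_zero.1 h0).symm

theorem hbDecomp_spec {n : ℕ} {ξ : Fin n → ℂ} {m : Fin n → ℕ} {f : ℂ → ℂ} (h : MemHb ξ m f) :
    HbDecompOf ξ m f (hbDecomp ξ m f).1 (hbDecomp ξ m f).2 := by
  unfold hbDecomp
  rw [dif_pos h]
  exact h.choose_spec

theorem hbNormSq_eq {n : ℕ} (ξ : Fin n → ℂ) (m : Fin n → ℕ) (hξ : ∀ j, ‖ξ j‖ = 1)
    (hinj : Function.Injective ξ) (hm : ∀ j, 0 < m j) {f g : ℂ → ℂ} {q : ℂ[X]}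
    (h : HbDecompOf ξ m f g q) : hbNormSq ξ m f = h2NormSq g + h2NormSq fun z => q.eval z := by
  obtain ⟨h1, h2⟩ := hb_unique ξ m hξ hinj hm (hbDecomp_spec ⟨(g, q), h⟩) h
  rw [hbNormSq, h1, h2NormSq_congr h.1.1 h2]

theorem memHb_sub {n : ℕ} {ξ : Fin n → ℂ} {m : Fin n → ℕ} {f f' : ℂ → ℂ} (h : MemHb ξ m f)
    (h' : MemHb ξ m f') : MemHb ξ m fun z => f z - f' z := by
  obtain ⟨⟨g, q⟩, h⟩ := h
  obtain ⟨⟨g', q'⟩, h'⟩ := h'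
  refine ⟨(fun z => g z - g' z, q - q'), memH2_sub h.1 h'.1,
    (Polynomial.degree_sub_le _ _).trans_lt (max_lt h.2.1 h'.2.1), fun z hz => ?_⟩
  have e1 := h.2.2 z hz
  have e2 := h'.2.2 z hz
  simp only [eval_sub] at *
  linear_combination e1 - e2

theorem schwarz_pick_bound {φ : ℂ → ℂ} (hd : DifferentiableOn ℂ φ unitDisk)
    (hmap : ∀ z ∈ unitDisk, φ z ∈ unitDisk) :
    ∃ c : ℝ, 0 < c ∧ c ≤ 1 ∧ ∀ z ∈ unitDisk, c * (1 - ‖z‖) ≤ 1 - ‖φ z‖ := by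
  set α := φ 0 with hα
  have hαD : α ∈ unitDisk := hmap 0 (mem_of_norm_lt (by simp))
  have hα1 := norm_lt_of_mem hαD
  have ident : ∀ w : ℂ, ‖1 - (starRingEnd ℂ) α * w‖ ^ 2 - ‖w - α‖ ^ 2 =
      (1 - ‖α‖ ^ 2) * (1 - ‖w‖ ^ 2) := by
    intro w
    simp only [← Complex.normSq_eq_norm_sq, Complex.normSq_apply, Complex.sub_re, Complex.sub_im,
      Complex.mul_re, Complex.mul_im, Complex.conj_re, Complex.conj_im, Complex.one_re,
      Complex.one_im]
    ring
  have hden : ∀ w ∈ unitDisk, 0 < ‖1 - (starRingEnd ℂ) α * w‖ := fun w hw => by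
    have := (khat_denom hαD hw).1
    linarith
  refine ⟨(1 - ‖α‖) ^ 2 / 2, by have : 0 < 1 - ‖α‖ := by linarith
                                positivity, by nlinarith [norm_nonneg α], fun z hz => ?_⟩
  have hw := hmap z hz
  have hs : ‖(φ z - α) / (1 - (starRingEnd ℂ) α * φ z)‖ ≤ ‖z‖ := by
    apply Complex.norm_le_norm_of_mapsTo_ball (R := 1)
      (f := fun z => (φ z - α) / (1 - (starRingEnd ℂ) α * φ z)) _ _ _ (norm_lt_of_mem hz)
    · apply DifferentiableOn.div (hd.sub_const α)
      · exact (hd.const_mul _).const_sub 1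
      · intro x hx
        exact norm_pos_iff.1 (hden _ (hmap x hx))
    · intro x hx
      have hx' := hden _ (hmap x hx)
      simp only [Metric.mem_closedBall, dist_zero_right, norm_div]
      rw [div_le_one hx']
      have h1 := norm_lt_of_mem (hmap x hx)
      have h2 := ident (φ x)
      have h3 : 0 ≤ (1 - ‖α‖ ^ 2) * (1 - ‖φ x‖ ^ 2) :=
        mul_nonneg (by nlinarith [norm_nonneg α]) (by nlinarith [norm_nonneg (φ x)])
      exact le_of_sq_le_sq (by linarith) hx'.le
    · simp [hα]
  rw [norm_div, div_le_iff₀ (hden _ hw)] at hs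
  have h1 := norm_lt_of_mem hw
  have h2 := ident (φ z)
  have h3 := (khat_denom hαD hw).1
  have hz1 := norm_lt_of_mem hz
  set D := ‖1 - (starRingEnd ℂ) α * φ z‖
  have h4 : ‖φ z - α‖ ^ 2 ≤ (‖z‖ * D) ^ 2 := by gcongr
  have h5 : D ^ 2 * (1 - ‖z‖ ^ 2) ≤ (1 - ‖α‖ ^ 2) * (1 - ‖φ z‖ ^ 2) := by nlinarith
  have h6 : (1 - ‖α‖ ^ 2) * (1 - ‖φ z‖ ^ 2) ≤ 2 * (1 - ‖φ z‖) := by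
    have : 0 ≤ 1 - ‖φ z‖ ^ 2 := by nlinarith [norm_nonneg (φ z)]
    nlinarith [norm_nonneg (φ z), norm_nonneg α, sq_nonneg ‖α‖]
  have h7 : (1 - ‖α‖) ^ 2 * (1 - ‖z‖) ≤ D ^ 2 * (1 - ‖z‖ ^ 2) := by
    have h8 : 0 ≤ 1 - ‖α‖ := by linarith
    have h9 : 1 - ‖z‖ ≤ 1 - ‖z‖ ^ 2 := by nlinarith [norm_nonneg z]
    have h10 : 0 ≤ 1 - ‖z‖ := by linarith
    gcongr
  linarith

theorem phi_rate {n : ℕ} (ξ : Fin n → ℂ) (m : Fin n → ℕ) (hξ : ∀ j, ‖ξ j‖ = 1)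
    (hm : ∀ j, 0 < m j) (k : Fin n) (hk : 2 ≤ m k) {φ : ℂ → ℂ} (hφ : MemHb ξ m φ) {ζ : ℂ}
    (hlim : Tendsto (fun r : ℝ => φ (r * ξ k)) (𝓝[<] 1) (𝓝 ζ)) :
    ∃ B : ℝ, 0 ≤ B ∧ ∀ r ∈ Set.Ioo (0:ℝ) 1, ‖φ (r * ξ k) - ζ‖ ≤ B * (1 - r) := by
  obtain ⟨⟨h, P⟩, hh, -, hdec⟩ := hφ
  simp only at hh hdec
  obtain ⟨C₀, hC0, hC⟩ := a1g_small ξ m hξ k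
  have hPz : P.eval (ξ k) = ζ := by
    have h1 := a1g_tendsto ξ m hξ hm k hh 0 (by omega)
    simp only [pow_zero, div_one] at h1
    have h2 := tendsto_zero_iff_norm_tendsto_zero.2 h1
    have h3 : Tendsto (fun r : ℝ => P.eval (r * ξ k)) (𝓝[<] 1) (𝓝 (P.eval (ξ k))) :=
      (P.continuous.tendsto _).comp radial_tendsto
    have h4 := h2.add h3
    rw [zero_add] at h4
    refine tendsto_nhds_unique (h4.congr' ?_) hlim
    filter_upwards [Ioo_mem_nhdsLT (zero_lt_one' ℝ)] with r hr
    exact (hdec _ (radial_mem (hξ k) hr)).symm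
  obtain ⟨S, hS⟩ := Polynomial.X_sub_C_dvd_sub_C_eval (a := ξ k) (p := P)
  obtain ⟨M, hM⟩ := (isCompact_closedBall (0:ℂ) 1).exists_bound_of_continuousOn
    S.continuous.continuousOn
  have hM0 : 0 ≤ M := (norm_nonneg _).trans (hM 0 (by simp))
  refine ⟨C₀ * √(h2NormSq h) + M, by positivity, fun r hr => ?_⟩
  have h0 : 0 < 1 - r := by linarith [hr.2]
  have e1 := hC h hh r hr
  rw [pow_div_sqrt h0 (hm k)] at e1
  have e2 : √(1 - r) * (1 - r) ^ (m k - 1) ≤ 1 - r := by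
    have a1 : √(1 - r) ≤ 1 := Real.sqrt_le_one.2 (by linarith [hr.1])
    have a2 : (1 - r) ^ (m k - 1) ≤ (1 - r) ^ 1 :=
      pow_le_pow_of_le_one h0.le (by linarith [hr.1]) (by omega)
    rw [pow_one] at a2
    calc _ ≤ 1 * (1 - r) := by gcongr
      _ = _ := one_mul _
  have e3 : P.eval (r * ξ k) - ζ = (r * ξ k - ξ k) * S.eval (r * ξ k) := by
    have := congrArg (fun p => Polynomial.eval ((r : ℂ) * ξ k) p) hS
    simpa [hPz] using this
  have e4 : ‖P.eval (r * ξ k) - ζ‖ ≤ M * (1 - r) := by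
    rw [e3, norm_mul, norm_radial_sub (hξ k) hr.2, mul_comm]
    gcongr
    exact hM _ (by simpa using (norm_lt_of_mem (radial_mem (hξ k) hr)).le)
  rw [hdec _ (radial_mem (hξ k) hr), add_sub_assoc]
  calc _ ≤ _ := norm_add_le _ _
    _ ≤ C₀ * √(h2NormSq h) * (1 - r) + M * (1 - r) := by
      refine add_le_add (e1.trans ?_) e4
      gcongr
    _ = _ := by ring

theorem phi_ratio {n : ℕ} (ξ : Fin n → ℂ) (m : Fin n → ℕ) (hξ : ∀ j, ‖ξ j‖ = 1)
    (hm : ∀ j, 0 < m j) (k l : Fin n) (hkl : m l ≤ m k) {φ : ℂ → ℂ} (hφ : MemHb ξ m φ)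
    (hlim : Tendsto (fun r : ℝ => φ (r * ξ k)) (𝓝[<] 1) (𝓝 (ξ l))) :
    Tendsto (fun r : ℝ => ‖φ (r * ξ k) - ξ l‖ ^ m l / (1 - r) ^ (m l - 1)) (𝓝[<] 1) (𝓝 0) := by
  have h0 : Tendsto (fun r : ℝ => ‖φ (r * ξ k) - ξ l‖) (𝓝[<] 1) (𝓝 0) := by
    have := (hlim.sub_const (ξ l)).norm
    simpa using this
  by_cases h1 : m l = 1
  · simpa [h1] using h0
  have hl := hm l
  obtain ⟨B, hB0, hB⟩ := phi_rate ξ m hξ hm k (by omega) hφ hlim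
  have h2 := h0.const_mul (B ^ (m l - 1))
  rw [mul_zero] at h2
  refine squeeze_zero' ?_ ?_ h2
  · filter_upwards [Ioo_mem_nhdsLT (zero_lt_one' ℝ)] with r hr
    have : 0 ≤ 1 - r := by linarith [hr.2]
    positivity
  filter_upwards [Ioo_mem_nhdsLT (zero_lt_one' ℝ)] with r hr
  have hr0 : 0 < 1 - r := by linarith [hr.2]
  rw [div_le_iff₀ (by positivity)]
  have e : m l = (m l - 1) + 1 := by omega
  conv_lhs => rw [e, pow_succ]
  calc _ ≤ (B * (1 - r)) ^ (m l - 1) * ‖φ (r * ξ k) - ξ l‖ := by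
        gcongr
        exact hB r hr
    _ = _ := by rw [mul_pow]; ring

theorem khat_small {w z : ℂ} (hw : w ∈ unitDisk) (hz : z ∈ unitDisk) :
    ‖khat w z‖ ≤ √(1 - ‖w‖ ^ 2) / (1 - ‖z‖) ∧ ‖khat w z‖ ≤ √(1 - ‖w‖ ^ 2) / (1 - ‖w‖) := by
  have h := khat_denom hw hz
  have h1 : 0 < 1 - ‖w‖ := by linarith [norm_lt_of_mem hw]
  have h2 : 0 < 1 - ‖z‖ := by linarith [norm_lt_of_mem hz]
  rw [khat, norm_div, Complex.norm_real, Real.norm_eq_abs, abs_of_nonneg (Real.sqrt_nonneg _)]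
  constructor
  · gcongr
    exact h.2
  · gcongr
    exact h.1

theorem q_dvd {n : ℕ} (ξ : Fin n → ℂ) (m : Fin n → ℕ) (hξ : ∀ j, ‖ξ j‖ = 1)
    (hm : ∀ j, 0 < m j) (k l : Fin n) (hkl : m l ≤ m k) {φ : ℂ → ℂ} (hφ : MemHb ξ m φ)
    (hmap : ∀ z ∈ unitDisk, φ z ∈ unitDisk)
    (hlim : Tendsto (fun r : ℝ => φ (r * ξ k)) (𝓝[<] 1) (𝓝 (ξ l)))
    {w : ℂ} (hw : w ∈ unitDisk) {g : ℂ → ℂ} {q : ℂ[X]}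
    (hdec : HbDecompOf ξ m (fun z => a1fun ξ m (φ z) * khat w (φ z)) g q) :
    (X - C (ξ k)) ^ m l ∣ q := by
  apply dvd_of_small _ _ (hξ k)
  obtain ⟨A, hA0, hA⟩ := a1fun_upper ξ m l
  set T := √(1 - ‖w‖ ^ 2) / (1 - ‖w‖) with hT
  have hT0 : 0 ≤ T := div_nonneg (Real.sqrt_nonneg _) (by linarith [norm_lt_of_mem hw])
  have h1 := (phi_ratio ξ m hξ hm k l hkl hφ hlim).const_mul (A * T)
  have h2 := a1g_tendsto ξ m hξ hm k hdec.1 (m l - 1) (by omega)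
  have h3 := h1.add h2
  rw [mul_zero, add_zero] at h3
  refine squeeze_zero' ?_ ?_ h3
  · filter_upwards [Ioo_mem_nhdsLT (zero_lt_one' ℝ)] with r hr
    have : 0 ≤ 1 - r := by linarith [hr.2]
    positivity
  filter_upwards [Ioo_mem_nhdsLT (zero_lt_one' ℝ)] with r hr
  have hr0 : 0 < 1 - r := by linarith [hr.2]
  have hzD := radial_mem (hξ k) hr
  have hφD := hmap _ hzD
  have e := hdec.2.2 _ hzD
  have e' : q.eval (r * ξ k) = a1fun ξ m (φ (r * ξ k)) * khat w (φ (r * ξ k)) -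
      a1fun ξ m (r * ξ k) * g (r * ξ k) := by
    linear_combination -e
  rw [← mul_div_assoc, ← add_div]
  gcongr
  rw [e']
  refine (norm_sub_le _ _).trans ?_
  gcongr
  rw [norm_mul]
  calc _ ≤ (A * ‖φ (r * ξ k) - ξ l‖ ^ m l) * T := by
        gcongr
        · exact hA _ (norm_lt_of_mem hφD).le
        · exact (khat_small hw hφD).2
    _ = _ := by ring

theorem khat_self {w : ℂ} (hw : w ∈ unitDisk) : ‖khat w w‖ = 1 / √(1 - ‖w‖ ^ 2) := by
  have hw1 := norm_lt_of_mem hw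
  have hs : 0 < 1 - ‖w‖ ^ 2 := by nlinarith [norm_nonneg w]
  have : (1 - (starRingEnd ℂ) w * w : ℂ) = ((1 - ‖w‖ ^ 2 : ℝ) : ℂ) := by
    rw [Complex.conj_mul']; push_cast; rfl
  rw [khat, this, norm_div, Complex.norm_real, Complex.norm_real, Real.norm_eq_abs,
    Real.norm_eq_abs, abs_of_nonneg (Real.sqrt_nonneg _), abs_of_pos hs, Real.sqrt_div_self']

theorem key_lower {n : ℕ} (ξ : Fin n → ℂ) (m : Fin n → ℕ) (hξ : ∀ j, ‖ξ j‖ = 1)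
    (hinj : Function.Injective ξ)
    (hm : ∀ j, 0 < m j) (k l : Fin n) (hkl : m l ≤ m k) {φ : ℂ → ℂ} (hφ : MemHb ξ m φ)
    (hd : DifferentiableOn ℂ φ unitDisk)
    (hmap : ∀ z ∈ unitDisk, φ z ∈ unitDisk)
    (hlim : Tendsto (fun r : ℝ => φ (r * ξ k)) (𝓝[<] 1) (𝓝 (ξ l))) :
    ∃ c : ℝ, 0 < c ∧ ∀ᶠ r : ℝ in 𝓝[<] 1, ∀ (g : ℂ → ℂ) (q : ℂ[X]),
      HbDecompOf ξ m (fun z => a1fun ξ m (φ z) * khat (φ (r * ξ k)) (φ z)) g q →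
      c ≤ √(h2NormSq g) + √(h2NormSq fun z => q.eval z) := by
  obtain ⟨c₁, hc1, hlow⟩ := a1fun_lower ξ m hinj l
  obtain ⟨c₂, hc2, -, hsp⟩ := schwarz_pick_bound hd hmap
  obtain ⟨A, hA0, hA⟩ := a1g_small ξ m hξ k
  obtain ⟨K, hK0, hK⟩ := poly_small (∑ j, m j) (m l) (ξ k)
  set c₀ := c₁ / √2 * (√c₂ * c₂ ^ (m l - 1)) with hc0
  have hc0p : 0 < c₀ := by positivity
  refine ⟨c₀ / (A + K + 1), by positivity, ?_⟩
  filter_upwards [Ioo_mem_nhdsLT (zero_lt_one' ℝ), hlim.eventually hlow] with r hr hlr g q hdec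
  have hδ : 0 < 1 - r := by linarith [hr.2]
  have hzD := radial_mem (hξ k) hr
  have hwD := hmap _ hzD
  have hdv := q_dvd ξ m hξ hm k l hkl hφ hmap hlim hwD hdec
  have hsub := norm_radial_sub (hξ k) hr.2
  have hq := hK q hdec.2.1 hdv (r * ξ k) (by rw [hsub]; linarith [hr.1])
  have hg := hA g hdec.1 r hr
  have hs := hsp _ hzD
  have he := hdec.2.2 _ hzD
  have hks := khat_self hwD
  rw [norm_radial (hξ k) hr.1] at hs
  rw [hsub] at hq
  rw [pow_div_sqrt hδ (hm k)] at hg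
  simp only at he
  set w := φ (r * ξ k) with hw
  set z : ℂ := r * ξ k with hz
  have hw1 := norm_lt_of_mem hwD
  set δ := 1 - r with hδdef
  set η := 1 - ‖w‖ with hη
  have hη0 : 0 < η := by rw [hη]; linarith
  set E := √δ * δ ^ (m l - 1) with hE
  have hE0 : 0 < E := by positivity
  set a := √(h2NormSq g)
  set b := √(h2NormSq fun z => q.eval z)
  have ha0 : 0 ≤ a := Real.sqrt_nonneg _
  have hb0 : 0 ≤ b := Real.sqrt_nonneg _
  have hδ1 : δ ≤ 1 := by linarith [hr.1]
  have up : ‖a1fun ξ m w * khat w w‖ ≤ (A * a + K * b) * E := by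
    rw [he]
    refine (norm_add_le _ _).trans ?_
    rw [add_mul]
    refine add_le_add (hg.trans ?_) (hq.trans ?_)
    · rw [hE]
      gcongr A * a * (_ * ?_)
      exact pow_le_pow_of_le_one hδ.le hδ1 (by omega)
    · gcongr
      have : δ ^ m l = √δ * E := by
        have h1 : δ ^ m l = √δ * √δ * δ ^ (m l - 1) := by
          rw [Real.mul_self_sqrt hδ.le, ← pow_succ', Nat.sub_add_cancel (hm l)]
        rw [h1, hE]; ring
      rw [this]
      have : √δ ≤ 1 := Real.sqrt_le_one.2 hδ1
      nlinarith
  have lo : c₀ * E ≤ ‖a1fun ξ m w * khat w w‖ := by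
    rw [norm_mul, hks]
    have h1 : η ≤ ‖w - ξ l‖ := by
      have := norm_sub_norm_le (ξ l) w
      rw [hξ l, norm_sub_rev] at this
      exact this
    have hsq : 0 < 1 - ‖w‖ ^ 2 := by nlinarith [norm_nonneg w]
    have h2 : √(1 - ‖w‖ ^ 2) ≤ √2 * √η := by
      rw [← Real.sqrt_mul (by norm_num)]
      apply Real.sqrt_le_sqrt
      nlinarith [norm_nonneg w]
    have h3 : 0 < √(1 - ‖w‖ ^ 2) := Real.sqrt_pos.2 hsq
    have h4 : √c₂ * √δ ≤ √η := by
      rw [← Real.sqrt_mul hc2.le]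
      exact Real.sqrt_le_sqrt hs
    calc c₀ * E = c₁ / √2 * ((√c₂ * √δ) * (c₂ * δ) ^ (m l - 1)) := by
          rw [hc0, hE, mul_pow]; ring
      _ ≤ c₁ / √2 * (√η * η ^ (m l - 1)) := by gcongr
      _ = (c₁ * η ^ m l) * (1 / (√2 * √η)) := by
          rw [← pow_div_sqrt hη0 (hm l)]
          field_simp
      _ ≤ ‖a1fun ξ m w‖ * (1 / √(1 - ‖w‖ ^ 2)) := by
          gcongr
          refine le_trans ?_ hlr
          gcongr
  have fin : c₀ ≤ A * a + K * b := le_of_mul_le_mul_right (lo.trans up) hE0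
  rw [div_le_iff₀ (by positivity)]
  nlinarith [mul_nonneg hA0 hb0, mul_nonneg hK0 ha0]

theorem main_contra {n : ℕ} (ξ : Fin n → ℂ) (m : Fin n → ℕ) (hξ : ∀ j, ‖ξ j‖ = 1)
    (hinj : Function.Injective ξ)
    (hm : ∀ j, 0 < m j) (k l : Fin n) (hkl : m l ≤ m k) {φ : ℂ → ℂ} (hφ : MemHb ξ m φ)
    (hd : DifferentiableOn ℂ φ unitDisk)
    (hmap : ∀ z ∈ unitDisk, φ z ∈ unitDisk)
    (hlim : Tendsto (fun r : ℝ => φ (r * ξ k)) (𝓝[<] 1) (𝓝 (ξ l)))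
    (hcpt : CompCompactHb ξ m φ) : False := by
  obtain ⟨c, hc, hlow⟩ := key_lower ξ m hξ hinj hm k l hkl hφ hd hmap hlim
  set ρ : ℕ → ℝ := fun i => 1 - 1 / ((i : ℝ) + 2) with hρ
  have hρm : ∀ i, ρ i ∈ Set.Ioo (0:ℝ) 1 := by
    intro i
    have h2 : (0:ℝ) < (i : ℝ) + 2 := by positivity
    have h3 : 1 / ((i : ℝ) + 2) < 1 := by
      rw [div_lt_one h2]
      have : (0:ℝ) ≤ i := by positivity
      linarith
    have h4 : 0 < 1 / ((i : ℝ) + 2) := by positivity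
    constructor <;> simp only [hρ] <;> linarith
  have hρt : Tendsto ρ atTop (𝓝[<] 1) := by
    refine tendsto_nhdsWithin_iff.2 ⟨?_, Eventually.of_forall fun i => (hρm i).2⟩
    have h1 : Tendsto (fun i : ℕ => 1 / ((i : ℝ) + 2)) atTop (𝓝 0) := by
      have := tendsto_one_div_add_atTop_nhds_zero_nat (𝕜 := ℝ)
      have h2 := this.comp (tendsto_add_atTop_nat 1)
      refine h2.congr fun i => ?_
      simp only [Function.comp]
      push_cast
      ring
    have h2 := h1.const_sub 1
    rwa [sub_zero] at h2
  set w : ℕ → ℂ := fun i => φ (ρ i * ξ k) with hw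
  have hwD : ∀ i, w i ∈ unitDisk := fun i => hmap _ (radial_mem (hξ k) (hρm i))
  have hwt : Tendsto w atTop (𝓝 (ξ l)) := hlim.comp hρt
  set f : ℕ → ℂ → ℂ := fun i z => a1fun ξ m z * khat (w i) z with hf
  have hfdec : ∀ i, HbDecompOf ξ m (f i) (khat (w i)) 0 := by
    intro i
    refine ⟨(khat_memH2 (hwD i)).1, ?_, fun z _ => by simp [hf]⟩
    rw [degree_zero]
    exact WithBot.bot_lt_coe _
  have hfnorm : ∀ i, MemHb ξ m (f i) ∧ hbNormSq ξ m (f i) ≤ 1 := by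
    intro i
    refine ⟨⟨(_, _), hfdec i⟩, ?_⟩
    rw [hbNormSq_eq ξ m hξ hinj hm (hfdec i), (khat_memH2 (hwD i)).2]
    have : h2NormSq (fun z => (0 : ℂ[X]).eval z) = 0 := by
      unfold h2NormSq
      simp only [taylorCoeff_poly]
      simp
    rw [this, add_zero]
  obtain ⟨κ, g, hκ, hg, hconv⟩ := hcpt.2 f hfnorm
  set F : ℕ → ℂ → ℂ := fun i z => f (κ i) (φ z) - g z with hF
  have hFm : ∀ i, MemHb ξ m (F i) := fun i => memHb_sub (hcpt.1.1 _ (hfnorm (κ i)).1) hg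
  set G : ℕ → ℂ → ℂ := fun i => (hbDecomp ξ m (F i)).1 with hG
  set Q : ℕ → ℂ[X] := fun i => (hbDecomp ξ m (F i)).2 with hQ
  have hdec : ∀ i, HbDecompOf ξ m (F i) (G i) (Q i) := fun i => hbDecomp_spec (hFm i)
  set ε : ℕ → ℝ := fun i => √(hbNormSq ξ m (F i)) with hε
  have hεt : Tendsto ε atTop (𝓝 0) := by
    have := (Real.continuous_sqrt.tendsto 0).comp hconv
    rwa [Real.sqrt_zero] at this
  have hGε : ∀ i, √(h2NormSq (G i)) ≤ ε i := fun i =>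
    Real.sqrt_le_sqrt (le_add_of_nonneg_right (h2NormSq_nonneg _))
  have hQε : ∀ i, √(h2NormSq fun z => (Q i).eval z) ≤ ε i := fun i =>
    Real.sqrt_le_sqrt (le_add_of_nonneg_left (h2NormSq_nonneg _))
  have hκt := hκ.tendsto_atTop
  have hg0 : ∀ z ∈ unitDisk, g z = 0 := by
    intro z hz
    have h1 : Tendsto (fun i => F i z) atTop (𝓝 0) := by
      have hb := hεt.const_mul (‖a1fun ξ m z‖ / √(1 - ‖z‖) + 1 / √(1 - ‖z‖))
      rw [mul_zero] at hb
      refine squeeze_zero_norm (fun i => ?_) hb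
      rw [(hdec i).2.2 z hz]
      refine (norm_add_le _ _).trans ?_
      have e1 := h2_growth (hdec i).1 hz
      have e2 := h2_growth (memH2_poly (Q i)) hz
      rw [norm_mul]
      calc _ ≤ ‖a1fun ξ m z‖ * (ε i / √(1 - ‖z‖)) + ε i / √(1 - ‖z‖) := by
            gcongr
            · exact e1.trans (by gcongr; exact hGε i)
            · exact e2.trans (by gcongr; exact hQε i)
        _ = _ := by ring
    have h2 : Tendsto (fun i => f (κ i) (φ z)) atTop (𝓝 0) := by
      have hs : Tendsto (fun i => √(1 - ‖w (κ i)‖ ^ 2)) atTop (𝓝 0) := by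
        have hc : Continuous (fun u : ℂ => √(1 - ‖u‖ ^ 2)) := by fun_prop
        have := (hc.tendsto (ξ l)).comp (hwt.comp hκt)
        have e : √(1 - ‖ξ l‖ ^ 2) = 0 := by simp [hξ l]
        rw [e] at this
        exact this
      have hb := hs.const_mul (‖a1fun ξ m (φ z)‖ * (1 / (1 - ‖φ z‖)))
      rw [mul_zero] at hb
      refine squeeze_zero_norm (fun i => ?_) hb
      have := (khat_small (hwD (κ i)) (hmap z hz)).1
      simp only [hf, norm_mul]
      calc _ ≤ ‖a1fun ξ m (φ z)‖ * (√(1 - ‖w (κ i)‖ ^ 2) / (1 - ‖φ z‖)) := by gcongr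
        _ = _ := by ring
    have h3 := h2.sub h1
    simp only [hF, sub_sub_cancel, sub_zero] at h3
    exact tendsto_nhds_unique tendsto_const_nhds h3
  have hev : ∀ᶠ i in atTop, c ≤ ε i + ε i := by
    filter_upwards [(hρt.comp hκt).eventually hlow] with i hi
    refine (hi (G i) (Q i) ⟨(hdec i).1, (hdec i).2.1, fun z hz => ?_⟩).trans
      (add_le_add (hGε i) (hQε i))
    have := (hdec i).2.2 z hz
    simp only [hF, hg0 z hz, sub_zero] at this
    exact this
  have := ge_of_tendsto (hεt.add hεt) hev
  linarith

/-- Corollary 5.6. If `C_φ` is compact on `H(b)` and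
`φ(ξ_k) = ξ_{ℓ_k}` for `k < p`, then `m_k < m_{ℓ_k}` for every `k < p`; in particular the
`ξ_k` (`k < p`) cannot be fixed points of `φ`. -/
theorem compact_implies_strict_multiplicities
    (b a : ℂ → ℂ) (n : ℕ) (ξ : Fin n → ℂ) (m : Fin n → ℕ)
    (hset : RationalSetting b a n ξ m)
    (φ : ℂ → ℂ) (hφb : MemHb ξ m φ) (hφball : MemBallHinf φ)
    (hφmap : ∀ z ∈ unitDisk, φ z ∈ unitDisk)
    (Λ : Fin n → ℂ) (hΛ : ∀ j, NTLimit φ (ξ j) (Λ j))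
    (p : ℕ) (hp : p ≤ n)
    (hΛcirc : ∀ j : Fin n, (j : ℕ) < p → ∃ i, Λ j = ξ i)
    (hΛdisk : ∀ j : Fin n, p ≤ (j : ℕ) → Λ j ∈ unitDisk)
    (l : Fin n → Fin n) (hl : ∀ k : Fin n, (k : ℕ) < p → Λ k = ξ (l k))
    (hcpt : CompCompactHb ξ m φ) :
    (∀ k : Fin n, (k : ℕ) < p → m k < m (l k)) ∧
    (∀ k : Fin n, (k : ℕ) < p → ¬ NTLimit φ (ξ k) (ξ k)) := by
  have hξ : ∀ j, ‖ξ j‖ = 1 := fun j => by simpa [unitCircle] using hset.zeros_mem j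
  have hmain : ∀ k : Fin n, (k : ℕ) < p → m k < m (l k) := by
    intro k hk
    by_contra hcon
    have hlim := ntlimit_radial (hξ k) (hΛ k)
    rw [hl k hk] at hlim
    exact main_contra ξ m hξ hset.zeros_inj hset.mult_pos k (l k) (not_lt.1 hcon) hφb hφball.1
      hφmap hlim hcpt
  refine ⟨hmain, fun k hk hfix => ?_⟩
  have h1 := tendsto_nhds_unique (ntlimit_radial (hξ k) hfix) (ntlimit_radial (hξ k) (hΛ k))
  rw [hl k hk] at h1
  have h2 := hmain k hk
  rw [← hset.zeros_inj h1] at h2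
  exact lt_irrefl _ h2

end
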